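/- arXiv:1708.05523 — 2 statements merged into one kernel-verified Lean document; each statement's English description precedes it below -/
import Mathlib

section
/- Let v ∈ W^P and let β be a minimal element of Ψ ∖ Φ⁺(v) with respect to the dominance order, and set α = v(β). Then α is a simple root and s_α v > v in the Bruhat order. -/
open scoped RealInnerProductSpace
open Classical

noncomputable section

variable (V : Type) [NormedAddCommGroup V] [InnerProductSpace ℝ V]

/-- The reflection determined by a vector `α` (the identity map if `α = 0`),
as a linear endomorphism:  `x ↦ x - (2⟪x,α⟫/⟪α,α⟫) • α`. -/
def reflMap (α : V) : V →ₗ[ℝ] V where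
  toFun x := x - (2 * ⟪x, α⟫ / ⟪α, α⟫) • α
  map_add' x y := by
    simp only [inner_add_left]
    rw [show 2 * (⟪x, α⟫ + ⟪y, α⟫) / ⟪α, α⟫
        = 2 * ⟪x, α⟫ / ⟪α, α⟫ + 2 * ⟪y, α⟫ / ⟪α, α⟫ by ring, add_smul]
    abel
  map_smul' c x := by
    simp only [real_inner_smul_left, RingHom.id_apply, smul_sub]
    rw [show 2 * (c * ⟪x, α⟫) / ⟪α, α⟫ = c * (2 * ⟪x, α⟫ / ⟪α, α⟫) by ring,
      mul_smul]

lemma reflMap_apply (α x : V) :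
    reflMap V α x = x - (2 * ⟪x, α⟫ / ⟪α, α⟫) • α := rfl

lemma reflMap_involutive (α : V) : ∀ x, reflMap V α (reflMap V α x) = x := by
  intro x
  by_cases h : (⟪α, α⟫ : ℝ) = 0
  · have h0 : α = 0 := inner_self_eq_zero.mp h
    simp [reflMap_apply, h0]
  · rw [reflMap_apply, reflMap_apply, inner_sub_left, real_inner_smul_left,
      div_mul_cancel₀ _ h]
    rw [show ⟪x, α⟫ - 2 * ⟪x, α⟫ = -⟪x, α⟫ by ring]
    rw [show 2 * -⟪x, α⟫ / ⟪α, α⟫ = -(2 * ⟪x, α⟫ / ⟪α, α⟫) by ring, neg_smul]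
    abel

/-- The reflection determined by a vector `α`, as a linear automorphism of `V`. -/
def sref (α : V) : V ≃ₗ[ℝ] V :=
  { reflMap V α with
    invFun := reflMap V α
    left_inv := reflMap_involutive V α
    right_inv := reflMap_involutive V α }

lemma sref_apply (α x : V) :
    sref V α x = x - (2 * ⟪x, α⟫ / ⟪α, α⟫) • α := rfl

variable {V}

/-- The coroot `α^∨ = 2α/⟪α,α⟫` associated with a root `α`, under the identification of the
coweight space with `V` given by the inner product. -/
def coroot (α : V) : V := (2 / ⟪α, α⟫) • α

/-- The dimension of the `(-1)`-eigenspace of a linear automorphism. -/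
def lamEig (σ : V ≃ₗ[ℝ] V) : ℕ :=
  Module.finrank ℝ (Module.End.eigenspace (σ : V →ₗ[ℝ] V) (-1))

/-- The action `s_α ∘ σ` of a simple reflection on an involution: `s_α σ` if `s_α` and `σ`
commute, and `s_α σ s_α` otherwise. -/
def circAct (α : V) (σ : V ≃ₗ[ℝ] V) : V ≃ₗ[ℝ] V :=
  if sref V α * σ = σ * sref V α then sref V α * σ else sref V α * σ * sref V α

/-- A set of pairwise orthogonal vectors. -/
def OrthSet (S : Finset V) : Prop :=
  (↑S : Set V).Pairwise fun a b => ⟪a, b⟫ = 0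

/-- The product `σ_S` of the (commuting) reflections in the elements of an orthogonal set
`S`. -/
def sigmaOf (S : Finset V) : V ≃ₗ[ℝ] V :=
  (S.toList.map (sref V)).prod

variable (V)

/-- A finite crystallographic reduced root system in the Euclidean space `V`,
together with a fixed choice of simple roots. -/
structure RSD where
  /-- The set of roots. -/
  Φ : Finset V
  /-- The set of simple roots. -/
  Δ : Finset V
  nonzero : (0 : V) ∉ Φ
  span_top : Submodule.span ℝ (Φ : Set V) = ⊤
  reduced : ∀ α ∈ Φ, ∀ c : ℝ, c • α ∈ Φ → c = 1 ∨ c = -1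
  crystal : ∀ α ∈ Φ, ∀ β ∈ Φ, ∃ n : ℤ, (n : ℝ) = 2 * ⟪β, α⟫ / ⟪α, α⟫
  reflClosed : ∀ α ∈ Φ, ∀ β ∈ Φ, sref V α β ∈ Φ
  Δ_sub : Δ ⊆ Φ
  Δ_indep : LinearIndependent ℝ (fun x : (Δ : Set V) => (x : V))
  Δ_base : ∀ α ∈ Φ, (∃ c : V → ℕ, α = ∑ γ ∈ Δ, (c γ : ℝ) • γ) ∨
      (∃ c : V → ℕ, -α = ∑ γ ∈ Δ, (c γ : ℝ) • γ)

namespace RSD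

variable {V}
variable (D : RSD V)

/-- The set of positive roots. -/
def Pos : Set V :=
  {α | α ∈ D.Φ ∧ ∃ c : V → ℕ, α = ∑ γ ∈ D.Δ, (c γ : ℝ) • γ}

/-- The set of negative roots. -/
def Neg : Set V := {α | -α ∈ D.Pos}

/-- The Weyl group, as the subgroup of `GL(V)` generated by the simple reflections. -/
def W : Subgroup (V ≃ₗ[ℝ] V) := Subgroup.closure ((fun γ => sref V γ) '' ↑D.Δ)

/-- The length of `w`: the least number of simple reflections needed to write `w` as a
product of simple reflections. -/
def length (w : V ≃ₗ[ℝ] V) : ℕ :=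
  sInf {n | ∃ l : List V, l.length = n ∧ (∀ γ ∈ l, γ ∈ D.Δ) ∧ w = (l.map (sref V)).prod}

/-- The Bruhat order on the Weyl group: `u ≤ v` iff `v` is obtained from `u` by successively
multiplying by reflections, each time increasing the length. -/
def ble (u v : V ≃ₗ[ℝ] V) : Prop :=
  Relation.ReflTransGen
    (fun x y => (∃ β ∈ D.Φ, y = sref V β * x) ∧ D.length x < D.length y) u v

/-- The strict Bruhat order. -/
def blt (u v : V ≃ₗ[ℝ] V) : Prop := D.ble u v ∧ u ≠ v

/-- The dominance order: `y - x` is a nonnegative integer combination of simple roots. -/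
def dom (x y : V) : Prop := ∃ c : V → ℕ, y - x = ∑ γ ∈ D.Δ, (c γ : ℝ) • γ

/-- The dominance order on coweights: `y - x` is a nonnegative integer combination of simple
coroots. -/
def cdom (x y : V) : Prop := ∃ c : V → ℕ, y - x = ∑ γ ∈ D.Δ, (c γ : ℝ) • coroot γ

/-- The length `L(σ) = (ℓ(σ) + λ(σ))/2` of an involution `σ`, where `λ(σ)` is the dimension
of the `(-1)`-eigenspace of `σ`. -/
def Linv (σ : V ≃ₗ[ℝ] V) : ℚ :=
  ((D.length σ : ℚ) + (lamEig σ : ℚ)) / 2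

end RSD

/-- A finite irreducible crystallographic reduced root system, with a fixed choice of simple
roots and a marked simple root `αP` whose coefficient in the highest root `θ` equals `1`
(the cominuscule case). -/
structure MRSD extends RSD V where
  irred : ¬ ∃ A B : Set V, A.Nonempty ∧ B.Nonempty ∧ A ∪ B = ↑Φ ∧
      ∀ α ∈ A, ∀ β ∈ B, ⟪α, β⟫ = 0
  /-- The marked simple root. -/
  αP : V
  αP_mem : αP ∈ Δ
  /-- The highest root. -/
  θ : V
  θ_mem : θ ∈ Φ
  θ_high : ∀ α ∈ Φ, ∃ c : V → ℕ, θ - α = ∑ γ ∈ Δ, (c γ : ℝ) • γ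
  θ_coeff : ∃ c : V → ℕ, (θ = ∑ γ ∈ Δ, (c γ : ℝ) • γ) ∧ c αP = 1

namespace MRSD

variable {V}
variable (M : MRSD V)

/-- The set `Ψ` of positive roots in which the marked simple root `αP` has coefficient `1`. -/
def Psi : Set V :=
  {α | α ∈ M.Φ ∧ ∃ c : V → ℕ, (α = ∑ γ ∈ M.Δ, (c γ : ℝ) • γ) ∧ c M.αP = 1}

/-- The set of positive roots of the subsystem `Φ_P`, i.e. the positive roots in which the
marked simple root `αP` has coefficient `0`. -/
def PosP : Set V :=
  {α | α ∈ M.Φ ∧ ∃ c : V → ℕ, (α = ∑ γ ∈ M.Δ, (c γ : ℝ) • γ) ∧ c M.αP = 0}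

/-- The parabolic subgroup `W_P` generated by the simple reflections in `Δ ∖ {αP}`. -/
def WP : Subgroup (V ≃ₗ[ℝ] V) :=
  Subgroup.closure ((fun γ => sref V γ) '' ↑(M.Δ.erase M.αP))

/-- The inversion set `Φ⁺(v) = {α ∈ Φ⁺ : v(α) ∈ Φ⁻}`. -/
def InvSet (v : V ≃ₗ[ℝ] V) : Set V := {α | α ∈ M.Pos ∧ v α ∈ M.Neg}

/-- `v` belongs to `W^P`: it lies in `W` and has minimal length in its coset `v W_P`. -/
def IsMinRep (v : V ≃ₗ[ℝ] V) : Prop :=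
  v ∈ M.W ∧ ∀ u, u ∈ M.W → v⁻¹ * u ∈ M.WP → M.length v ≤ M.length u

/-- `μ` is the minimal length representative `[w]^P` of the coset `w W_P`. -/
def IsMinRepOf (μ w : V ≃ₗ[ℝ] V) : Prop :=
  (μ ∈ M.W ∧ w⁻¹ * μ ∈ M.WP) ∧
    ∀ u, u ∈ M.W → w⁻¹ * u ∈ M.WP → M.length μ ≤ M.length u

/-- The subset `Φ_S = {α ∈ Φ : σ_S(α) = -α}` determined by an orthogonal set of roots `S`. -/
def PhiSet (S : Finset V) : Set V := {α | α ∈ M.Φ ∧ sigmaOf S α = -α}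

/-- A root is long if its squared length is maximal among the roots. -/
def IsLong (α : V) : Prop := ∀ β ∈ M.Φ, ⟪β, β⟫ ≤ ⟪α, α⟫

/-- Admissible pair: `v ∈ W^P`, `S ⊆ Ψ` a set of pairwise orthogonal roots with
`v(S) ⊆ Φ⁻`. -/
def Admissible (v : V ≃ₗ[ℝ] V) (S : Finset V) : Prop :=
  M.IsMinRep v ∧ (↑S : Set V) ⊆ M.Psi ∧ OrthSet S ∧ ∀ β ∈ S, v β ∈ M.Neg

/-- The length `L(v,S) = (ℓ(σ_{v(S)}) + |S|)/2` of an admissible pair `(v,S)`. -/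
def pairL (v : V ≃ₗ[ℝ] V) (S : Finset V) : ℚ :=
  ((M.length (sigmaOf (S.image fun x => v x)) : ℚ) + (S.card : ℚ)) / 2

end MRSD

section

variable {V}

lemma sref_sref (α x : V) : sref V α (sref V α x) = x := reflMap_involutive V α x

lemma sref_mul_self (α : V) : sref V α * sref V α = 1 := by
  ext x
  exact sref_sref α x

lemma sref_inv (α : V) : (sref V α)⁻¹ = sref V α :=
  inv_eq_of_mul_eq_one_left (sref_mul_self α)

lemma sref_self {α : V} (h : α ≠ 0) : sref V α α = -α := by
  have h' : (⟪α, α⟫ : ℝ) ≠ 0 := inner_self_ne_zero.mpr h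
  rw [sref_apply, mul_div_assoc, div_self h', mul_one, two_smul]
  abel

lemma inner_sref_sref (α x y : V) : (⟪sref V α x, sref V α y⟫ : ℝ) = ⟪x, y⟫ := by
  by_cases h : α = 0
  · simp [sref_apply, h]
  have h' : (⟪α, α⟫ : ℝ) ≠ 0 := inner_self_ne_zero.mpr h
  simp only [sref_apply, inner_sub_left, inner_sub_right, real_inner_smul_left,
    real_inner_smul_right, real_inner_comm α]
  field_simp
  ring

lemma sref_map_mul {w : V ≃ₗ[ℝ] V} (hw : ∀ x y : V, (⟪w x, w y⟫ : ℝ) = ⟪x, y⟫) (α : V) :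
    sref V (w α) * w = w * sref V α := by
  ext x
  simp only [LinearEquiv.mul_apply, sref_apply, map_sub, map_smul, hw]

lemma inner_map_prod_sref (l : List V) (x y : V) :
    (⟪(l.map (sref V)).prod x, (l.map (sref V)).prod y⟫ : ℝ) = ⟪x, y⟫ := by
  induction l with
  | nil => simp
  | cons a t ih => simp [inner_sref_sref, ih]

lemma prod_map_sref_reverse (l : List V) :
    (l.reverse.map (sref V)).prod = ((l.map (sref V)).prod)⁻¹ := by
  induction l with
  | nil => simp
  | cons a t ih =>
    rw [List.reverse_cons, List.map_append, List.prod_append, ih]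
    simp [sref_inv]

namespace RSD

variable (D : RSD V)

lemma neg_mem {α : V} (h : α ∈ D.Φ) : -α ∈ D.Φ := by
  have h0 : α ≠ 0 := fun e => D.nonzero (e ▸ h)
  simpa [sref_self h0] using D.reflClosed α h α h

/-- The nonnegative integer combinations of the simple roots. -/
def posCone : AddSubmonoid V where
  carrier := {x | ∃ c : V → ℕ, x = ∑ γ ∈ D.Δ, (c γ : ℝ) • γ}
  zero_mem' := ⟨0, by simp⟩
  add_mem' := by
    rintro _ _ ⟨c, rfl⟩ ⟨d, rfl⟩
    exact ⟨c + d, by simp [add_smul, Finset.sum_add_distrib]⟩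

lemma mem_posCone {x : V} :
    x ∈ D.posCone ↔ ∃ c : V → ℕ, x = ∑ γ ∈ D.Δ, (c γ : ℝ) • γ := Iff.rfl

lemma simple_mem_posCone {γ : V} (h : γ ∈ D.Δ) : γ ∈ D.posCone :=
  ⟨fun δ => if δ = γ then 1 else 0, by simp [h]⟩

lemma simple_mem_pos {γ : V} (h : γ ∈ D.Δ) : γ ∈ D.Pos :=
  ⟨D.Δ_sub h, D.simple_mem_posCone h⟩

lemma mem_pos_or_mem_neg {α : V} (h : α ∈ D.Φ) : α ∈ D.Pos ∨ α ∈ D.Neg :=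
  (D.Δ_base α h).imp (fun hc => ⟨h, hc⟩) (fun hc => ⟨D.neg_mem h, hc⟩)

lemma exists_coeff {γ : V} (hγ : γ ∈ D.Δ) :
    ∃ f : V →ₗ[ℝ] ℝ, ∀ c : V → ℕ, f (∑ δ ∈ D.Δ, (c δ : ℝ) • δ) = c γ := by
  have hs : LinearIndepOn ℝ id (D.Δ : Set V) := D.Δ_indep
  let b := Module.Basis.extend hs
  have hsub := Module.Basis.subset_extend hs
  refine ⟨b.coord ⟨γ, hsub hγ⟩, fun c => ?_⟩
  have key : ∀ δ ∈ D.Δ, b.coord ⟨γ, hsub hγ⟩ δ = if δ = γ then 1 else 0 := by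
    intro δ hδ
    have hb : b ⟨δ, hsub hδ⟩ = δ := Module.Basis.extend_apply_self hs _
    have h := b.repr_self ⟨δ, hsub hδ⟩
    rw [hb] at h
    rw [Module.Basis.coord_apply, h, Finsupp.single_apply]
    simp
  rw [map_sum, Finset.sum_congr rfl fun δ hδ => by rw [map_smul, key δ hδ]]
  simp [hγ]

lemma not_mem_neg_of_mem_pos {α : V} (h : α ∈ D.Pos) : α ∉ D.Neg := by
  rintro ⟨-, d, hd⟩
  obtain ⟨hα, c, hc⟩ := h
  apply D.nonzero
  suffices h0 : α = 0 by rwa [h0] at hα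
  rw [hc]
  refine Finset.sum_eq_zero fun δ hδ => ?_
  obtain ⟨f, hf⟩ := D.exists_coeff hδ
  have h1 := hf c
  have h2 := hf d
  rw [← hc] at h1
  rw [← hd, map_neg] at h2
  have h3 : (0 : ℝ) ≤ d δ := by positivity
  have h4 : (0 : ℝ) ≤ c δ := by positivity
  rw [show (c δ : ℝ) = 0 by linarith, zero_smul]

/-- Subtracting a multiple of a simple root `γ` from a positive root other than `γ` never
yields a negative root. -/
lemma sub_smul_mem_pos {α γ : V} (hα : α ∈ D.Pos) (hγ : γ ∈ D.Δ) (hne : α ≠ γ) {t : ℝ}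
    (ht : α - t • γ ∈ D.Φ) : α - t • γ ∈ D.Pos := by
  refine (D.mem_pos_or_mem_neg ht).resolve_right ?_
  rintro ⟨-, d, hd⟩
  obtain ⟨hαΦ, c, hc⟩ := id hα
  have hzero : ∀ δ ∈ D.Δ, δ ≠ γ → (c δ : ℝ) • δ = 0 := by
    intro δ hδ hδγ
    obtain ⟨f, hf⟩ := D.exists_coeff hδ
    have h1 := hf c
    have h2 := hf d
    have h5 : f γ = 0 := by
      have h := hf fun x => if x = γ then 1 else 0
      simpa [hγ, hδγ] using h
    rw [← hc] at h1
    rw [← hd, map_neg, map_sub, map_smul, h5] at h2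
    simp only [smul_zero, sub_zero] at h2
    have h3 : (0 : ℝ) ≤ d δ := by positivity
    have h4 : (0 : ℝ) ≤ c δ := by positivity
    rw [show (c δ : ℝ) = 0 by linarith, zero_smul]
  rw [Finset.sum_eq_single_of_mem γ hγ hzero] at hc
  rcases D.reduced γ (D.Δ_sub hγ) (c γ) (hc ▸ hαΦ) with h | h
  · exact hne (by rw [hc, h, one_smul])
  · have : (0 : ℝ) ≤ c γ := by positivity
    linarith

lemma sref_mem_pos {α γ : V} (hα : α ∈ D.Pos) (hγ : γ ∈ D.Δ) (hne : α ≠ γ) :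
    sref V γ α ∈ D.Pos :=
  D.sub_smul_mem_pos hα hγ hne (D.reflClosed γ (D.Δ_sub hγ) α hα.1)

/-- The difference of two distinct roots forming an acute angle is a root. -/
lemma sub_mem_of_inner_pos {α γ : V} (hα : α ∈ D.Φ) (hγ : γ ∈ D.Φ) (hne : α ≠ γ)
    (hpos : (0 : ℝ) < ⟪α, γ⟫) : α - γ ∈ D.Φ := by
  have hα0 : α ≠ 0 := fun e => D.nonzero (e ▸ hα)
  have hγ0 : γ ≠ 0 := fun e => D.nonzero (e ▸ hγ)
  have hαα : (0 : ℝ) < ⟪α, α⟫ := real_inner_self_pos.mpr hα0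
  have hγγ : (0 : ℝ) < ⟪γ, γ⟫ := real_inner_self_pos.mpr hγ0
  obtain ⟨n, hn⟩ := D.crystal γ hγ α hα
  obtain ⟨m, hm⟩ := D.crystal α hα γ hγ
  have hcomm : (⟪γ, α⟫ : ℝ) = ⟪α, γ⟫ := real_inner_comm _ _
  by_cases hn1 : n = 1
  · have h := D.reflClosed γ hγ α hα
    rw [sref_apply, ← hn, hn1] at h
    simpa using h
  by_cases hm1 : m = 1
  · have h := D.neg_mem (D.reflClosed α hα γ hγ)
    rw [sref_apply, ← hm, hm1] at h
    simpa using h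
  exfalso
  have hn0 : (0 : ℝ) < n := by rw [hn]; positivity
  have hm0 : (0 : ℝ) < m := by rw [hm, hcomm]; positivity
  have hn2 : (2 : ℝ) ≤ n := by
    have : 0 < n := by exact_mod_cast hn0
    exact_mod_cast (by omega : 2 ≤ n)
  have hm2 : (2 : ℝ) ≤ m := by
    have : 0 < m := by exact_mod_cast hm0
    exact_mod_cast (by omega : 2 ≤ m)
  have e1 : (n : ℝ) * ⟪γ, γ⟫ = 2 * ⟪α, γ⟫ := by rw [hn]; field_simp
  have e2 : (m : ℝ) * ⟪α, α⟫ = 2 * ⟪α, γ⟫ := by rw [hm, hcomm]; field_simp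
  have e3 : (⟪α - γ, α - γ⟫ : ℝ) ≤ 0 := by
    simp only [inner_sub_left, inner_sub_right, hcomm]
    nlinarith
  exact hne (sub_eq_zero.mp (inner_self_eq_zero.mp (e3.antisymm real_inner_self_nonneg)))

/-- A positive root that is not simple is the sum of a simple root and a positive root. -/
lemma exists_simple_sub_mem_pos {α : V} (hα : α ∈ D.Pos) (hns : α ∉ D.Δ) :
    ∃ γ ∈ D.Δ, α - γ ∈ D.Pos := by
  have hα0 : α ≠ 0 := fun e => D.nonzero (e ▸ hα.1)
  obtain ⟨hαΦ, c, hc⟩ := id hα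
  have hsum : (0 : ℝ) < ∑ γ ∈ D.Δ, c γ * ⟪α, γ⟫ := by
    have h : (⟪α, α⟫ : ℝ) = ∑ γ ∈ D.Δ, c γ * ⟪α, γ⟫ := by
      calc (⟪α, α⟫ : ℝ) = ⟪α, ∑ γ ∈ D.Δ, (c γ : ℝ) • γ⟫ := by rw [← hc]
        _ = _ := by simp only [inner_sum, real_inner_smul_right]
    rw [← h]
    exact real_inner_self_pos.mpr hα0
  obtain ⟨γ, hγ, hpos⟩ : ∃ γ ∈ D.Δ, (0 : ℝ) < c γ * ⟪α, γ⟫ := by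
    by_contra! h
    exact hsum.not_ge (Finset.sum_nonpos h)
  have hγα : (0 : ℝ) < ⟪α, γ⟫ := pos_of_mul_pos_right hpos (by positivity)
  have hne : α ≠ γ := fun e => hns (e ▸ hγ)
  refine ⟨γ, hγ, ?_⟩
  have h := D.sub_mem_of_inner_pos hαΦ (D.Δ_sub hγ) hne hγα
  simpa using D.sub_smul_mem_pos (t := 1) hα hγ hne (by simpa using h)

lemma exists_word {w : V ≃ₗ[ℝ] V} (hw : w ∈ D.W) :
    ∃ l : List V, (∀ γ ∈ l, γ ∈ D.Δ) ∧ w = (l.map (sref V)).prod := by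
  induction hw using Subgroup.closure_induction with
  | mem x hx =>
    obtain ⟨γ, hγ, rfl⟩ := hx
    exact ⟨[γ], by simpa using hγ, by simp⟩
  | one => exact ⟨[], by simp, by simp⟩
  | mul x y _ _ hx hy =>
    obtain ⟨l, hl, rfl⟩ := hx
    obtain ⟨l', hl', rfl⟩ := hy
    refine ⟨l ++ l', fun γ hγ => ?_, by simp⟩
    exact (List.mem_append.mp hγ).elim (hl γ) (hl' γ)
  | inv x _ hx =>
    obtain ⟨l, hl, rfl⟩ := hx
    exact ⟨l.reverse, by simpa using hl, (prod_map_sref_reverse l).symm⟩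

lemma prod_sref_mem {l : List V} (hl : ∀ γ ∈ l, γ ∈ D.Δ) {α : V} (hα : α ∈ D.Φ) :
    (l.map (sref V)).prod α ∈ D.Φ := by
  induction l with
  | nil => simpa
  | cons a t ih =>
    simp only [List.forall_mem_cons] at hl
    simpa using D.reflClosed a (D.Δ_sub hl.1) _ (ih hl.2)

lemma apply_mem {w : V ≃ₗ[ℝ] V} (hw : w ∈ D.W) {α : V} (hα : α ∈ D.Φ) : w α ∈ D.Φ := by
  obtain ⟨l, hl, rfl⟩ := D.exists_word hw
  exact D.prod_sref_mem hl hα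

lemma sref_mem_W {γ : V} (hγ : γ ∈ D.Δ) : sref V γ ∈ D.W :=
  Subgroup.subset_closure ⟨γ, hγ, rfl⟩

lemma length_le {l : List V} (hl : ∀ γ ∈ l, γ ∈ D.Δ) :
    D.length (l.map (sref V)).prod ≤ l.length :=
  Nat.sInf_le ⟨l, rfl, hl, rfl⟩

lemma exists_reduced_word {w : V ≃ₗ[ℝ] V} (hw : w ∈ D.W) :
    ∃ l : List V, l.length = D.length w ∧ (∀ γ ∈ l, γ ∈ D.Δ) ∧ w = (l.map (sref V)).prod := by
  obtain ⟨l, hl, hw⟩ := D.exists_word hw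
  exact Nat.sInf_mem
    (s := {n | ∃ l : List V, l.length = n ∧ (∀ γ ∈ l, γ ∈ D.Δ) ∧ w = (l.map (sref V)).prod})
    ⟨l.length, l, rfl, hl, hw⟩

lemma length_inv_le {w : V ≃ₗ[ℝ] V} (hw : w ∈ D.W) : D.length w⁻¹ ≤ D.length w := by
  obtain ⟨l, hlen, hl, rfl⟩ := D.exists_reduced_word hw
  rw [← hlen, ← prod_map_sref_reverse, ← List.length_reverse]
  exact D.length_le (by simpa using hl)

lemma length_inv {w : V ≃ₗ[ℝ] V} (hw : w ∈ D.W) : D.length w⁻¹ = D.length w :=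
  le_antisymm (D.length_inv_le hw) (by simpa using D.length_inv_le (inv_mem hw))

/-- The exchange condition. -/
lemma exchange {γ : V} (hγ : γ ∈ D.Pos) {l : List V} (hl : ∀ δ ∈ l, δ ∈ D.Δ)
    (hneg : (l.map (sref V)).prod γ ∈ D.Neg) :
    ∃ l' : List V, l'.length < l.length ∧ (∀ δ ∈ l', δ ∈ D.Δ) ∧
      (l.map (sref V)).prod * sref V γ = (l'.map (sref V)).prod := by
  induction l with
  | nil => exact absurd (by simpa using hneg) (D.not_mem_neg_of_mem_pos hγ)
  | cons a t ih =>
    simp only [List.forall_mem_cons] at hl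
    rcases D.mem_pos_or_mem_neg (D.prod_sref_mem hl.2 hγ.1) with hp | hn
    · have ha : (t.map (sref V)).prod γ = a := by
        by_contra hne
        exact D.not_mem_neg_of_mem_pos (D.sref_mem_pos hp hl.1 hne) (by simpa using hneg)
      refine ⟨t, by simp, hl.2, ?_⟩
      have h := sref_map_mul (inner_map_prod_sref t) γ
      rw [ha] at h
      rw [List.map_cons, List.prod_cons, mul_assoc, ← h, ← mul_assoc, sref_mul_self, one_mul]
    · obtain ⟨l', hlen, hl', hprod⟩ := ih hl.2 hn
      refine ⟨a :: l', by simpa using hlen, ?_, ?_⟩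
      · simpa using ⟨hl.1, hl'⟩
      · simp [mul_assoc, hprod]

lemma length_mul_sref_lt {w : V ≃ₗ[ℝ] V} (hw : w ∈ D.W) {γ : V} (hγ : γ ∈ D.Pos)
    (hneg : w γ ∈ D.Neg) : D.length (w * sref V γ) < D.length w := by
  obtain ⟨l, hlen, hl, rfl⟩ := D.exists_reduced_word hw
  obtain ⟨l', hlt, hl', hprod⟩ := D.exchange hγ hl hneg
  rw [hprod, ← hlen]
  exact (D.length_le hl').trans_lt hlt

lemma length_lt_sref_mul {w : V ≃ₗ[ℝ] V} (hw : w ∈ D.W) {γ : V} (hγ : γ ∈ D.Δ)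
    (hpos : w⁻¹ γ ∈ D.Pos) : D.length w < D.length (sref V γ * w) := by
  have hsw : sref V γ * w ∈ D.W := mul_mem (D.sref_mem_W hγ) hw
  have hγ0 : γ ≠ 0 := fun e => D.nonzero (e ▸ D.Δ_sub hγ)
  have hinv : (sref V γ * w)⁻¹ = w⁻¹ * sref V γ := by rw [mul_inv_rev, sref_inv]
  have h := D.length_mul_sref_lt (inv_mem hsw) (D.simple_mem_pos hγ) (by
    rw [hinv, LinearEquiv.mul_apply, sref_self hγ0, map_neg]
    simpa [Neg] using hpos)
  rw [D.length_inv hsw, hinv, mul_assoc, sref_mul_self, mul_one, D.length_inv hw] at h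
  exact h

end RSD

namespace MRSD

variable (M : MRSD V)

lemma IsMinRep.apply_simple_mem_pos {v : V ≃ₗ[ℝ] V} (hv : M.IsMinRep v) {γ : V}
    (hγ : γ ∈ M.Δ.erase M.αP) : v γ ∈ M.Pos := by
  have hγΔ := Finset.mem_of_mem_erase hγ
  refine (M.mem_pos_or_mem_neg (M.apply_mem hv.1 (M.Δ_sub hγΔ))).resolve_right fun hneg => ?_
  refine (M.length_mul_sref_lt hv.1 (M.simple_mem_pos hγΔ) hneg).not_ge ?_
  refine hv.2 _ (mul_mem hv.1 (M.sref_mem_W hγΔ)) ?_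
  rw [inv_mul_cancel_left]
  exact Subgroup.subset_closure ⟨γ, hγ, rfl⟩

lemma IsMinRep.apply_mem_pos {v : V ≃ₗ[ℝ] V} (hv : M.IsMinRep v) {α : V}
    (hα : α ∈ M.PosP) : v α ∈ M.Pos := by
  obtain ⟨hαΦ, c, hc, hc0⟩ := hα
  refine ⟨M.apply_mem hv.1 hαΦ, ?_⟩
  rw [← M.mem_posCone, hc, map_sum]
  refine sum_mem fun γ hγ => ?_
  rw [map_smul, Nat.cast_smul_eq_nsmul]
  by_cases h : γ = M.αP
  · simp [h, hc0]
  · exact nsmul_mem (hv.apply_simple_mem_pos M (Finset.mem_erase.mpr ⟨h, hγ⟩)).2 _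

end MRSD

end

/-- Let `v ∈ W^P` and let `β` be minimal in `Ψ ∖ Φ⁺(v)` for the dominance
order, and set `α = v(β)`.  Then `α` is a simple root and `s_α v > v`. -/
theorem statement6 {V : Type} [NormedAddCommGroup V] [InnerProductSpace ℝ V]
    [FiniteDimensional ℝ V]
    (M : MRSD V) (v : V ≃ₗ[ℝ] V) (β : V)
    (hv : M.IsMinRep v) (hβ : β ∈ M.Psi \ M.InvSet v)
    (hmin : ∀ γ ∈ M.Psi \ M.InvSet v, M.dom γ β → γ = β) :
    v β ∈ M.Δ ∧ M.blt v (sref V (v β) * v) := by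
  obtain ⟨hβΨ, hβinv⟩ := hβ
  obtain ⟨hβΦ, b, hb, hb1⟩ := id hβΨ
  have hα : v β ∈ M.Pos := (M.mem_pos_or_mem_neg (M.apply_mem hv.1 hβΦ)).resolve_right
    fun h => hβinv ⟨⟨hβΦ, b, hb⟩, h⟩
  obtain ⟨f, hf⟩ := M.exists_coeff M.αP_mem
  have hfβ : f β = 1 := by rw [hb, hf, hb1, Nat.cast_one]
  have hf_le : ∀ α ∈ M.Φ, f α ≤ 1 := by
    intro α hα
    obtain ⟨c, hc⟩ := M.θ_high α hα
    obtain ⟨d, hd, hd1⟩ := M.θ_coeff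
    have h1 := hf c
    have h2 := hf d
    rw [← hc, map_sub] at h1
    rw [← hd, hd1, Nat.cast_one] at h2
    have h3 : (0 : ℝ) ≤ c M.αP := by positivity
    linarith
  have hf_int : ∀ α ∈ M.Φ, ∃ n : ℤ, f α = n := by
    intro α hα
    rcases M.Δ_base α hα with ⟨c, hc⟩ | ⟨c, hc⟩
    · exact ⟨c M.αP, by rw [hc, hf, Int.cast_natCast]⟩
    · exact ⟨-c M.αP, by rw [← neg_neg α, map_neg, hc, hf, Int.cast_neg, Int.cast_natCast]⟩
  have not_sum : ∀ x y : V, x ∈ M.Φ → y ∈ M.Φ → v x ∈ M.Pos → v y ∈ M.Pos → f x = 1 →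
      f y = 0 → x + y ≠ β := by
    intro x y hx hy hvx hvy hfx hfy hxy
    have hxΨ : x ∈ M.Psi := by
      refine ⟨hx, ?_⟩
      rcases M.Δ_base x hx with ⟨c, hc⟩ | ⟨c, hc⟩
      · exact ⟨c, hc, by rw [hc, hf] at hfx; exact_mod_cast hfx⟩
      · have h1 := hf c
        rw [← hc, map_neg, hfx] at h1
        have h3 : (0 : ℝ) ≤ c M.αP := by positivity
        linarith
    have hypos : y ∈ M.posCone := by
      rcases M.Δ_base y hy with hc | ⟨c, hc⟩
      · exact hc
      · have h1 := hf c
        rw [← hc, map_neg, hfy, neg_zero] at h1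
        have h2 := hv.apply_mem_pos M (α := -y) ⟨M.neg_mem hy, c, hc, by exact_mod_cast h1.symm⟩
        rw [map_neg] at h2
        exact absurd h2 (M.not_mem_neg_of_mem_pos hvy)
    have hdom : M.dom x β := by
      rw [← hxy]
      simpa [RSD.dom] using M.mem_posCone.mp hypos
    have hxβ := hmin x ⟨hxΨ, fun h => M.not_mem_neg_of_mem_pos hvx h.2⟩ hdom
    rw [hxβ, add_eq_left] at hxy
    exact M.nonzero (hxy ▸ hy)
  have hsimple : v β ∈ M.Δ := by
    by_contra hns
    obtain ⟨γ, hγ, hδ⟩ := M.exists_simple_sub_mem_pos hα hns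
    have hx : v⁻¹ γ ∈ M.Φ := M.apply_mem (inv_mem hv.1) (M.Δ_sub hγ)
    have hy : v⁻¹ (v β - γ) ∈ M.Φ := M.apply_mem (inv_mem hv.1) hδ.1
    have hvinv : ∀ z, v (v⁻¹ z) = z := v.apply_symm_apply
    have hxy : v⁻¹ γ + v⁻¹ (v β - γ) = β := by
      rw [← map_add, add_sub_cancel]
      exact v.symm_apply_apply β
    have hvx : v (v⁻¹ γ) ∈ M.Pos := by
      rw [hvinv]
      exact M.simple_mem_pos hγ
    have hvy : v (v⁻¹ (v β - γ)) ∈ M.Pos := by rwa [hvinv]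
    have hfsum : f (v⁻¹ γ) + f (v⁻¹ (v β - γ)) = 1 := by rw [← map_add, hxy, hfβ]
    obtain ⟨m, hm⟩ := hf_int _ hx
    obtain ⟨n, hn⟩ := hf_int _ hy
    have hm1 := hf_le _ hx
    have hn1 := hf_le _ hy
    rw [hm] at hm1
    rw [hn] at hn1
    rw [hm, hn] at hfsum
    norm_cast at hm1 hn1 hfsum
    rcases (by omega : m = 1 ∧ n = 0 ∨ m = 0 ∧ n = 1) with ⟨rfl, rfl⟩ | ⟨rfl, rfl⟩
    · exact not_sum _ _ hx hy hvx hvy (by simpa using hm) (by simpa using hn) hxy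
    · exact not_sum _ _ hy hx hvy hvx (by simpa using hn) (by simpa using hm)
        (by rw [add_comm, hxy])
  have hlt : M.length v < M.length (sref V (v β) * v) := by
    refine M.length_lt_sref_mul hv.1 hsimple ?_
    rw [show v⁻¹ (v β) = β from v.symm_apply_apply β]
    exact ⟨hβΦ, b, hb⟩
  exact ⟨hsimple, .single ⟨⟨v β, hα.1, rfl⟩, hlt⟩, fun h => hlt.ne (congrArg M.length h)⟩
end
end

section
/- Let β, β′ ∈ Ψ be orthogonal roots. Then neither β + β′ nor β − β′ is a root of Φ. -/
open scoped RealInnerProductSpace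
open Classical

noncomputable section

variable (V : Type) [NormedAddCommGroup V] [InnerProductSpace ℝ V]

variable {V}

variable (V)

/-- No root is the sum of two elements of `Ψ`, since its coefficient at `αP` would exceed that
of the highest root. -/
lemma MRSD.add_notMem_of_mem_Psi {V : Type} [NormedAddCommGroup V] [InnerProductSpace ℝ V]
    (M : MRSD V) {β β' : V} (hβ : β ∈ M.Psi) (hβ' : β' ∈ M.Psi) : β + β' ∉ M.Φ := by
  intro hsum
  obtain ⟨-, b, hb, hbP⟩ := hβ
  obtain ⟨-, b', hb', hbP'⟩ := hβ'
  obtain ⟨t, ht, htP⟩ := M.θ_coeff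
  obtain ⟨d, hd⟩ := M.θ_high _ hsum
  have hindep : LinearIndepOn ℝ id (M.Δ : Set V) := M.Δ_indep
  have hzero : ∑ γ ∈ M.Δ, ((t γ : ℝ) - (b γ + b' γ) - d γ) • id γ = 0 := by
    simp only [sub_smul, add_smul, Finset.sum_sub_distrib, Finset.sum_add_distrib, id]
    rw [← ht, ← hb, ← hb', ← hd, sub_self]
  have hcoeff := linearIndepOn_finset_iff.mp hindep _ hzero _ M.αP_mem
  rw [hbP, hbP', htP] at hcoeff
  have hnonneg : (0 : ℝ) ≤ d M.αP := Nat.cast_nonneg _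
  push_cast at hcoeff
  linarith

/-- Let `β, β' ∈ Ψ` be orthogonal roots.  Then neither `β + β'` nor
`β - β'` is a root. -/
theorem statement12 {V : Type} [NormedAddCommGroup V] [InnerProductSpace ℝ V]
    [FiniteDimensional ℝ V]
    (M : MRSD V) (β β' : V) (hβ : β ∈ M.Psi) (hβ' : β' ∈ M.Psi)
    (horth : ⟪β, β'⟫ = 0) :
    β + β' ∉ M.Φ ∧ β - β' ∉ M.Φ := by
  have hadd := M.add_notMem_of_mem_Psi hβ hβ'
  refine ⟨hadd, fun hsub => hadd ?_⟩
  have hne : (⟪β', β'⟫ : ℝ) ≠ 0 := fun h =>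
    M.nonzero (inner_self_eq_zero.mp h ▸ hβ'.1)
  have hrefl := M.reflClosed β' hβ'.1 _ hsub
  have hcoef : 2 * ⟪β - β', β'⟫ / ⟪β', β'⟫ = (-2 : ℝ) := by
    rw [inner_sub_left, horth, zero_sub]
    field_simp
  rw [sref_apply, hcoef] at hrefl
  convert hrefl using 1
  module
end
end
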